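/- arXiv:0903.5125 — 2 statements merged into one kernel-verified Lean document; each statement's English description precedes it below -/
import Mathlib

section
/- There exists a zero-free function f in the Korenblum class A^{-∞} such that G_+(f) = [0,2π), i.e., for every θ ∈ [0,2π) one has limsup_{r→1} log|f(re^{iθ})| / |log(1−r)| > 0. -/
open Filter MeasureTheory

noncomputable section

/-- The Korenblum class `A^{-∞}`: `f` analytic on the unit disc with
`|f(z)| ≤ C (1-|z|)^{-k}` for some constants `C, k > 0`. -/
def Korenblum (f : ℂ → ℂ) : Prop :=
  DifferentiableOn ℂ f (Metric.ball 0 1) ∧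
    ∃ C k : ℝ, 0 < C ∧ 0 < k ∧ ∀ z ∈ Metric.ball (0:ℂ) 1, ‖f z‖ ≤ C / (1 - ‖z‖) ^ k

/-- Quantitative form of the fact that `cos θ`, `cos 2θ`, `cos 3θ`, `cos 4θ` are never
simultaneously non-positive, in terms of `x = cos θ`. -/
lemma chebyshev_cover (x : ℝ) (h1 : x < 1 / 4) (h2 : 2 * x ^ 2 - 1 < 1 / 4)
    (h3 : 4 * x ^ 3 - 3 * x < 1 / 4) : 1 / 4 ≤ 8 * x ^ 4 - 8 * x ^ 2 + 1 := by
  by_contra! h4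
  have hx : x < -(3 / 10) := by
    by_contra! hx
    nlinarith [mul_nonneg (sub_nonneg.2 hx) (sub_nonneg.2 h1.le), sq_nonneg (x ^ 2)]
  have hx' : -(4 / 5) < x := by nlinarith
  nlinarith [mul_pos (sub_pos.2 hx) (sub_pos.2 hx'),
    mul_pos (mul_pos (sub_pos.2 hx) (sub_pos.2 hx')) (sub_pos.2 hx)]

/-- There is a polynomial vanishing at `0` whose real part is positive somewhere on every radius
of the unit disc, uniformly. -/
lemma exists_radially_positive :
    ∃ (p : ℂ → ℂ) (M η X : ℝ), Differentiable ℂ p ∧ 0 < M ∧ 0 < η ∧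
      (∀ w : ℂ, ‖w‖ ≤ 1 → ‖p w‖ ≤ M * ‖w‖) ∧
      ∀ ζ : ℂ, ‖ζ‖ = 1 → ∃ x : ℝ, 2 ≤ x ∧ x ≤ X ∧ η ≤ (p (Real.exp (-x) * ζ)).re := by
  refine ⟨fun w => 10 ^ 9 * w + 10 ^ 16 * w ^ 2 + 10 ^ 21 * w ^ 3 + 10 ^ 24 * w ^ 4,
    10 ^ 9 + 10 ^ 16 + 10 ^ 21 + 10 ^ 24, 1 / 10, Real.log (10 ^ 8), by fun_prop, by norm_num,
    by norm_num, fun w hw => ?_, fun ζ hζ => ?_⟩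
  · have hp : ∀ n : ℕ, ‖w‖ ^ (n + 1) ≤ ‖w‖ := fun n =>
      pow_le_of_le_one (norm_nonneg w) hw n.succ_ne_zero
    refine (norm_add_le _ _).trans ?_
    refine (add_le_add_left ((norm_add_le _ _).trans (add_le_add_left (norm_add_le _ _) _)) _).trans
      ?_
    simp only [norm_mul, norm_pow, Complex.norm_ofNat]
    have p2 : ‖w‖ ^ 2 ≤ ‖w‖ := hp 1
    have p3 : ‖w‖ ^ 3 ≤ ‖w‖ := hp 2
    have p4 : ‖w‖ ^ 4 ≤ ‖w‖ := hp 3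
    linarith
  · have key : ∀ ρ : ℝ, (10 ^ 8)⁻¹ ≤ ρ → ρ ≤ (10 ^ 2)⁻¹ →
        1 / 10 ≤ 10 ^ 9 * (ρ * ζ.re) + 10 ^ 16 * (ρ ^ 2 * (2 * ζ.re ^ 2 - 1)) +
          10 ^ 21 * (ρ ^ 3 * (4 * ζ.re ^ 3 - 3 * ζ.re)) +
          10 ^ 24 * (ρ ^ 4 * (8 * ζ.re ^ 4 - 8 * ζ.re ^ 2 + 1)) →
        ∃ x : ℝ, 2 ≤ x ∧ x ≤ Real.log (10 ^ 8) ∧ 1 / 10 ≤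
          ((fun w : ℂ => 10 ^ 9 * w + 10 ^ 16 * w ^ 2 + 10 ^ 21 * w ^ 3 + 10 ^ 24 * w ^ 4)
            (Real.exp (-x) * ζ)).re := by
      intro ρ h1 h2 h
      have hρ : 0 < ρ := lt_of_lt_of_le (by norm_num) h1
      refine ⟨-Real.log ρ, ?_, ?_, ?_⟩
      · rw [le_neg, Real.log_le_iff_le_exp hρ, Real.exp_neg]
        refine h2.trans (inv_anti₀ (Real.exp_pos _) ?_)
        have : Real.exp 2 = Real.exp 1 ^ 2 := by rw [← Real.exp_nat_mul]; norm_num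
        rw [this]
        exact pow_le_pow_left₀ (Real.exp_pos _).le (by linarith [Real.exp_one_lt_d9]) 2
      · rw [neg_le, ← Real.log_inv]
        exact Real.log_le_log (by norm_num) h1
      · rw [neg_neg, Real.exp_log hρ]
        have hy : ζ.im ^ 2 = 1 - ζ.re ^ 2 := by
          have := Complex.sq_norm ζ
          rw [hζ, Complex.normSq_apply] at this
          linarith
        have e2 : (ζ ^ 2).re = 2 * ζ.re ^ 2 - 1 := by
          have : (ζ ^ 2).re = ζ.re ^ 2 - ζ.im ^ 2 := by simp [pow_two]
          rw [this, hy]; ring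
        have e3 : (ζ ^ 3).re = 4 * ζ.re ^ 3 - 3 * ζ.re := by
          have : (ζ ^ 3).re = ζ.re ^ 3 - 3 * ζ.re * ζ.im ^ 2 := by
            simp [pow_succ]; ring
          rw [this, hy]; ring
        have e4 : (ζ ^ 4).re = 8 * ζ.re ^ 4 - 8 * ζ.re ^ 2 + 1 := by
          have : (ζ ^ 4).re = ζ.re ^ 4 - 6 * ζ.re ^ 2 * ζ.im ^ 2 + (ζ.im ^ 2) ^ 2 := by
            simp [pow_succ]; ring
          rw [this, hy]; ring
        have e : ∀ (c : ℝ) (n : ℕ), ((c : ℂ) * (ρ * ζ) ^ n).re = c * (ρ ^ n * (ζ ^ n).re) := by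
          intro c n
          rw [mul_pow, ← Complex.ofReal_pow, Complex.re_ofReal_mul, Complex.re_ofReal_mul]
        have f1 := e (10 ^ 9) 1
        have f2 := e (10 ^ 16) 2
        have f3 := e (10 ^ 21) 3
        have f4 := e (10 ^ 24) 4
        rw [e2] at f2
        rw [e3] at f3
        rw [e4] at f4
        push_cast at f1 f2 f3 f4
        simp only [pow_one] at f1
        simp only [Complex.add_re]
        rw [f1, f2, f3, f4]
        exact h
    have hx : |ζ.re| ≤ 1 := hζ ▸ Complex.abs_re_le_norm ζ
    obtain ⟨hl, hu⟩ := abs_le.1 hx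
    set x := ζ.re
    have hx2 : x ^ 2 ≤ 1 := by nlinarith
    have b2 : -1 ≤ 2 * x ^ 2 - 1 := by nlinarith
    have b3 : -1 ≤ 4 * x ^ 3 - 3 * x := by
      nlinarith [mul_nonneg (by linarith : (0:ℝ) ≤ x + 1) (sq_nonneg (2 * x - 1))]
    have b4 : -1 ≤ 8 * x ^ 4 - 8 * x ^ 2 + 1 := by nlinarith [sq_nonneg (2 * x ^ 2 - 1)]
    by_cases h1 : x < 1 / 4
    · by_cases h2 : 2 * x ^ 2 - 1 < 1 / 4
      · by_cases h3 : 4 * x ^ 3 - 3 * x < 1 / 4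
        · have h4 := chebyshev_cover x h1 h2 h3
          refine key (10 ^ 2)⁻¹ (by norm_num) le_rfl ?_
          norm_num only
          linarith
        · refine key (10 ^ 4)⁻¹ (by norm_num) (by norm_num) ?_
          norm_num only
          linarith
      · refine key (10 ^ 6)⁻¹ (by norm_num) (by norm_num) ?_
        norm_num only
        linarith
    · refine key (10 ^ 8)⁻¹ (by norm_num) (by norm_num) ?_
      norm_num only
      linarith

lemma sum_factorial_le (k : ℕ) :
    ∑ j ∈ Finset.range (k + 1), (j.factorial : ℝ) ≤ 2 * k.factorial := by
  induction k with
  | zero => norm_num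
  | succ k ih =>
    rw [Finset.sum_range_succ]
    rcases Nat.eq_zero_or_pos k with rfl | hk
    · norm_num
    · have : (2 : ℝ) * k.factorial ≤ (k + 1).factorial := by
        rw [Nat.factorial_succ]
        push_cast
        gcongr
        have : (1 : ℝ) ≤ k := by exact_mod_cast hk
        linarith
      linarith

lemma factorial_mul_pow_le {r : ℝ} (h0 : 0 ≤ r) (h1 : r < 1) (k : ℕ)
    (h : 1 ≤ (2 : ℝ) ^ k.factorial * (1 - r) ^ 2) :
    k.factorial * r ^ 2 ^ k.factorial ≤ 24 * (1 / 2 : ℝ) ^ k := by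
  set N : ℝ := (2 : ℝ) ^ k.factorial with hN
  have hN0 : 0 < N := by positivity
  have hy : 0 < N * (1 - r) := mul_pos hN0 (by linarith)
  have hr : r ^ 2 ^ k.factorial ≤ Real.exp (-(N * (1 - r))) := by
    have := pow_le_pow_left₀ h0 (by linarith [Real.add_one_le_exp (-(1 - r))] :
      r ≤ Real.exp (-(1 - r))) (2 ^ k.factorial)
    rw [← Real.exp_nat_mul] at this
    refine this.trans_eq ?_
    rw [hN]
    push_cast
    ring_nf
  have he : N ^ 2 / 24 ≤ Real.exp (N * (1 - r)) := by
    have h4 := Real.pow_div_factorial_le_exp (N * (1 - r)) hy.le 4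
    refine le_trans ?_ h4
    have : N ^ 2 ≤ (N * (1 - r)) ^ 4 := by
      have : (N * (1 - r)) ^ 4 = N ^ 2 * (N * (1 - r) ^ 2) ^ 2 := by ring
      rw [this]
      exact le_mul_of_one_le_right (by positivity) (one_le_pow₀ h)
    have h24 : ((Nat.factorial 4 : ℕ) : ℝ) = 24 := by norm_num [Nat.factorial]
    rw [h24]
    linarith
  have hr2 : r ^ 2 ^ k.factorial ≤ 24 / N ^ 2 := by
    refine hr.trans ?_
    rw [Real.exp_neg, ← inv_div]
    exact inv_anti₀ (by positivity) he
  have hf : (k.factorial : ℝ) ≤ N := by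
    rw [hN]; exact_mod_cast Nat.lt_two_pow_self.le
  have hk : (2 : ℝ) ^ k ≤ N := pow_le_pow_right₀ (by norm_num) (Nat.self_le_factorial k)
  calc k.factorial * r ^ 2 ^ k.factorial ≤ N * (24 / N ^ 2) := by gcongr
    _ = 24 * (1 / N) := by field_simp
    _ ≤ 24 * (1 / 2 ^ k) := by gcongr
    _ = _ := by rw [one_div_pow]

lemma summable_factorial_mul_pow {r : ℝ} (h0 : 0 ≤ r) (h1 : r < 1) :
    Summable fun k : ℕ => (k.factorial : ℝ) * r ^ 2 ^ k.factorial := by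
  have hs : Summable fun k : ℕ => 24 * (1 / 2 : ℝ) ^ k :=
    summable_geometric_two.mul_left 24
  refine Summable.of_norm_bounded_eventually_nat hs ?_
  have ht : Tendsto (fun k : ℕ => (2 : ℝ) ^ k * (1 - r) ^ 2) atTop atTop :=
    (tendsto_pow_atTop_atTop_of_one_lt one_lt_two).atTop_mul_const
      (pow_pos (by linarith) 2)
  filter_upwards [ht.eventually_ge_atTop 1] with k hk
  rw [Real.norm_of_nonneg (by positivity)]
  refine factorial_mul_pow_le h0 h1 k (hk.trans ?_)
  gcongr
  · norm_num
  · exact Nat.self_le_factorial k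

lemma tsum_factorial_mul_pow_le {r : ℝ} (h0 : 0 ≤ r) (h1 : r < 1) :
    ∑' k : ℕ, (k.factorial : ℝ) * r ^ 2 ^ k.factorial ≤
      48 + 4 / Real.log 2 * (-Real.log (1 - r)) := by
  have hlog2 : 0 < Real.log 2 := Real.log_pos one_lt_two
  have hl : 0 ≤ -Real.log (1 - r) :=
    neg_nonneg.2 (Real.log_nonpos (by linarith) (by linarith))
  have hs := summable_geometric_two
  refine (summable_factorial_mul_pow h0 h1).tsum_le_of_sum_range_le fun n => ?_
  have hfin : ∀ n : ℕ, ∑ k ∈ Finset.range n, (k.factorial : ℝ) * r ^ 2 ^ k.factorial ≤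
      24 * ∑ k ∈ Finset.range n, (1 / 2 : ℝ) ^ k + 4 / Real.log 2 * (-Real.log (1 - r)) := by
    intro n
    induction n with
    | zero =>
      rw [Finset.sum_range_zero, Finset.sum_range_zero, mul_zero, zero_add]
      positivity
    | succ n ih =>
      by_cases h : 1 ≤ (2 : ℝ) ^ n.factorial * (1 - r) ^ 2
      · rw [Finset.sum_range_succ, Finset.sum_range_succ, mul_add]
        linarith [factorial_mul_pow_le h0 h1 n h]
      · push Not at h
        have hle : ∑ k ∈ Finset.range (n + 1), (k.factorial : ℝ) * r ^ 2 ^ k.factorial ≤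
            2 * n.factorial := by
          refine le_trans (Finset.sum_le_sum fun k _ => ?_) (sum_factorial_le n)
          exact mul_le_of_le_one_right (by positivity) (pow_le_one₀ h0 h1.le)
        have hlog := Real.log_nonpos (by positivity) h.le
        rw [Real.log_mul (by positivity) (pow_pos (by linarith) 2).ne', Real.log_pow,
          Real.log_pow] at hlog
        have : (n.factorial : ℝ) ≤ 2 / Real.log 2 * (-Real.log (1 - r)) := by
          rw [div_mul_eq_mul_div, le_div_iff₀ hlog2]
          push_cast at hlog
          linarith
        have hp : 0 ≤ 24 * ∑ k ∈ Finset.range (n + 1), (1 / 2 : ℝ) ^ k := by positivity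
        have e : 4 / Real.log 2 * (-Real.log (1 - r)) =
          2 * (2 / Real.log 2 * (-Real.log (1 - r))) := by ring
        linarith
  have := hs.sum_le_tsum (Finset.range n) (fun _ _ => by positivity)
  rw [tsum_geometric_two] at this
  linarith [hfin n]

/-- The lacunary series `∑ k! p(z ^ (2 ^ k!))`. -/
def lacunary (p : ℂ → ℂ) (z : ℂ) : ℂ := ∑' k : ℕ, (k.factorial : ℂ) * p (z ^ 2 ^ k.factorial)

section lacunary

variable {p : ℂ → ℂ} {M : ℝ}

lemma norm_lacunary_term_le (hp : ∀ w : ℂ, ‖w‖ ≤ 1 → ‖p w‖ ≤ M * ‖w‖) {z : ℂ} (hz : ‖z‖ ≤ 1)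
    (k : ℕ) : ‖(k.factorial : ℂ) * p (z ^ 2 ^ k.factorial)‖ ≤
      M * (k.factorial * ‖z‖ ^ 2 ^ k.factorial) := by
  rw [norm_mul, Complex.norm_natCast]
  have := hp (z ^ 2 ^ k.factorial) (by rw [norm_pow]; exact pow_le_one₀ (norm_nonneg z) hz)
  rw [norm_pow] at this
  calc _ ≤ (k.factorial : ℝ) * (M * ‖z‖ ^ 2 ^ k.factorial) := by gcongr
    _ = _ := by ring

lemma differentiableOn_lacunary (hM : 0 < M) (hpd : Differentiable ℂ p)
    (hp : ∀ w : ℂ, ‖w‖ ≤ 1 → ‖p w‖ ≤ M * ‖w‖) :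
    DifferentiableOn ℂ (lacunary p) (Metric.ball 0 1) := by
  intro z hz
  rw [mem_ball_zero_iff] at hz
  obtain ⟨R, hzR, hR⟩ := exists_between hz
  have hR0 : 0 ≤ R := (norm_nonneg z).trans hzR.le
  have hd : DifferentiableOn ℂ (lacunary p) (Metric.ball 0 R) := by
    refine Complex.differentiableOn_tsum_of_summable_norm
      ((summable_factorial_mul_pow hR0 hR).mul_left M) (fun k => ?_) Metric.isOpen_ball
      fun k w hw => ?_
    · exact (((hpd.comp (differentiable_id.pow _)).const_mul _)).differentiableOn
    · rw [mem_ball_zero_iff] at hw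
      refine (norm_lacunary_term_le hp (hw.le.trans hR.le) k).trans ?_
      gcongr
  exact (hd.differentiableAt
    (Metric.isOpen_ball.mem_nhds (mem_ball_zero_iff.2 hzR))).differentiableWithinAt

lemma norm_lacunary_le (hp : ∀ w : ℂ, ‖w‖ ≤ 1 → ‖p w‖ ≤ M * ‖w‖) (hM : 0 < M) {z : ℂ}
    (hz : ‖z‖ < 1) :
    ‖lacunary p z‖ ≤ M * (48 + 4 / Real.log 2 * (-Real.log (1 - ‖z‖))) := by
  refine (tsum_of_norm_bounded
    ((summable_factorial_mul_pow (norm_nonneg z) hz).mul_left M).hasSum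
    (norm_lacunary_term_le hp hz.le)).trans ?_
  rw [tsum_mul_left]
  exact mul_le_mul_of_nonneg_left (tsum_factorial_mul_pow_le (norm_nonneg z) hz) hM.le

lemma re_lacunary_ge (hp : ∀ w : ℂ, ‖w‖ ≤ 1 → ‖p w‖ ≤ M * ‖w‖) (hM : 0 < M) {z : ℂ}
    (hz : ‖z‖ < 1) {k : ℕ} (hk : 1 ≤ k) (hr : 1 ≤ (2 : ℝ) ^ k.factorial * (1 - ‖z‖)) :
    k.factorial * (p (z ^ 2 ^ k.factorial)).re - M * (2 * (k - 1).factorial) - M * 48 ≤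
      (lacunary p z).re := by
  set F : ℕ → ℂ := fun j => (j.factorial : ℂ) * p (z ^ 2 ^ j.factorial) with hF
  have hb : ∀ j, ‖F j‖ ≤ M * (j.factorial * ‖z‖ ^ 2 ^ j.factorial) :=
    norm_lacunary_term_le hp hz.le
  have hsum : Summable F :=
    ((summable_factorial_mul_pow (norm_nonneg z) hz).mul_left M).of_norm_bounded hb
  have hsplit : lacunary p z = ∑ j ∈ Finset.range k, F j + F k + ∑' j, F (j + (k + 1)) := by
    rw [← Finset.sum_range_succ, hsum.sum_add_tsum_nat_add]
    rfl
  have hhead : ‖∑ j ∈ Finset.range k, F j‖ ≤ M * (2 * (k - 1).factorial) := by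
    refine (norm_sum_le _ _).trans ?_
    calc ∑ j ∈ Finset.range k, ‖F j‖ ≤ ∑ j ∈ Finset.range k, M * (j.factorial : ℝ) := by
          refine Finset.sum_le_sum fun j _ => (hb j).trans ?_
          gcongr
          exact mul_le_of_le_one_right (by positivity) (pow_le_one₀ (norm_nonneg z) hz.le)
      _ ≤ _ := by
          rw [← Finset.mul_sum]
          have := sum_factorial_le (k - 1)
          rw [Nat.sub_add_cancel hk] at this
          gcongr
  have htail : ‖∑' j, F (j + (k + 1))‖ ≤ M * 48 := by
    have hg : HasSum (fun j : ℕ => M * (24 * (1 / 2 : ℝ) ^ j)) (M * (24 * 2)) :=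
      (hasSum_geometric_two.mul_left 24).mul_left M
    refine (tsum_of_norm_bounded hg fun j => ?_).trans (by linarith)
    refine (hb _).trans (mul_le_mul_of_nonneg_left ?_ hM.le)
    refine (factorial_mul_pow_le (norm_nonneg z) hz _ ?_).trans ?_
    · have hfac : k.factorial * 2 ≤ (j + (k + 1)).factorial := by
        refine le_trans ?_ (Nat.factorial_le (by omega : k + 1 ≤ j + (k + 1)))
        rw [Nat.factorial_succ, mul_comm]
        gcongr
        omega
      calc (1 : ℝ) ≤ ((2 : ℝ) ^ k.factorial * (1 - ‖z‖)) ^ 2 := one_le_pow₀ hr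
        _ = (2 : ℝ) ^ (k.factorial * 2) * (1 - ‖z‖) ^ 2 := by rw [mul_pow, pow_mul]
        _ ≤ _ := by
          gcongr
          norm_num
    · have : (1 / 2 : ℝ) ^ (j + (k + 1)) ≤ (1 / 2) ^ j :=
        pow_le_pow_of_le_one (by norm_num) (by norm_num) (by omega)
      linarith
  have hFk : (F k).re = k.factorial * (p (z ^ 2 ^ k.factorial)).re := by
    simp only [hF]
    rw [← Complex.ofReal_natCast, Complex.re_ofReal_mul]
  rw [hsplit, Complex.add_re, Complex.add_re, hFk]
  have h1 := neg_le_of_abs_le (Complex.abs_re_le_norm (∑ j ∈ Finset.range k, F j))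
  have h2 := neg_le_of_abs_le (Complex.abs_re_le_norm (∑' j, F (j + (k + 1))))
  linarith

end lacunary

lemma inv_le_one_sub_exp_neg_div {x N : ℝ} (hx : 2 ≤ x) (hN : 2 ≤ N) :
    1 ≤ N * (1 - Real.exp (-(x / N))) := by
  have hN0 : 0 < N := by linarith
  have h1 : 2 / N + 1 ≤ Real.exp (x / N) :=
    le_trans (by gcongr) (Real.add_one_le_exp _)
  have h2 : Real.exp (-(x / N)) ≤ N / (N + 2) := by
    rw [Real.exp_neg]
    refine (inv_anti₀ (by positivity) h1).trans (le_of_eq ?_)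
    field_simp
    ring
  calc 1 ≤ N * (1 - N / (N + 2)) := by
        have : N * (1 - N / (N + 2)) = 2 * N / (N + 2) := by field_simp; ring
        rw [this, le_div_iff₀ (by positivity)]
        linarith
    _ ≤ _ := by gcongr

/-- There is a zero-free `f ∈ A^{-∞}` such that for every `θ ∈ [0, 2π)`,
`limsup_{r→1⁻} log|f(re^{iθ})| / |log(1-r)| > 0`, i.e. `G_+(f) = [0, 2π)`. -/
theorem stmt5 :
    ∃ f : ℂ → ℂ, Korenblum f ∧ (∀ z ∈ Metric.ball (0:ℂ) 1, f z ≠ 0) ∧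
      ∀ θ ∈ Set.Ico (0:ℝ) (2 * Real.pi), ∃ c : ℝ, 0 < c ∧
        ∃ᶠ r : ℝ in nhdsWithin 1 (Set.Iio 1),
          c ≤ Real.log ‖f ((r : ℂ) * Complex.exp (Complex.I * (θ : ℂ)))‖ / |Real.log (1 - r)| := by
  obtain ⟨p, M, η, X, hpd, hM, hη, hp, hpos⟩ := exists_radially_positive
  have hlog2 : 0 < Real.log 2 := Real.log_pos one_lt_two
  refine ⟨fun z => Complex.exp (lacunary p z),
    ⟨(differentiableOn_lacunary hM hpd hp).cexp, Real.exp (M * 48), M * (4 / Real.log 2),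
      Real.exp_pos _, by positivity, fun z hz => ?_⟩, fun z _ => Complex.exp_ne_zero _,
    fun θ _ => ⟨η / 2, by positivity, ?_⟩⟩
  · rw [mem_ball_zero_iff] at hz
    rw [Complex.norm_exp, Real.rpow_def_of_pos (by linarith), ← Real.exp_sub]
    refine Real.exp_le_exp.2 ((Complex.re_le_norm _).trans
      ((norm_lacunary_le hp hM hz).trans (le_of_eq ?_)))
    ring
  · set ζ : ℂ := Complex.exp (Complex.I * (θ : ℂ)) with hζdef
    have hζ : ‖ζ‖ = 1 := by rw [hζdef, mul_comm]; exact Complex.norm_exp_ofReal_mul_I θ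
    have hx : ∀ k : ℕ, ∃ x : ℝ, 2 ≤ x ∧ x ≤ X ∧
        η ≤ (p (Real.exp (-x) * ζ ^ 2 ^ k.factorial)).re := fun k =>
      hpos _ (by rw [norm_pow, hζ, one_pow])
    choose x hx2 hxX hxp using hx
    set N : ℕ → ℝ := fun k => (2 : ℝ) ^ k.factorial with hN
    have hN2 : ∀ k, 2 ≤ N k := fun k =>
      le_self_pow₀ (by norm_num) (Nat.factorial_ne_zero k)
    have hN0 : ∀ k, 0 < N k := fun k => by linarith [hN2 k]
    set r : ℕ → ℝ := fun k => Real.exp (-(x k / N k)) with hr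
    have hr1 : ∀ k, r k < 1 := fun k =>
      Real.exp_lt_one_iff.2 (neg_neg_of_pos (div_pos (by linarith [hx2 k]) (hN0 k)))
    have hNtop : Tendsto N atTop atTop :=
      (tendsto_pow_atTop_atTop_of_one_lt one_lt_two).comp
        (tendsto_atTop_mono Nat.self_le_factorial tendsto_id)
    have hrt : Tendsto r atTop (nhdsWithin 1 (Set.Iio 1)) := by
      refine tendsto_nhdsWithin_iff.2 ⟨?_, Eventually.of_forall hr1⟩
      have hlow : Tendsto (fun k => 1 - X / N k) atTop (nhds 1) := by
        simpa using (hNtop.const_div_atTop X).const_sub 1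
      refine tendsto_of_tendsto_of_tendsto_of_le_of_le hlow tendsto_const_nhds
        (fun k => ?_) fun k => (hr1 k).le
      have h1 : x k / N k ≤ X / N k := div_le_div_of_nonneg_right (hxX k) (hN0 k).le
      have h2 := Real.add_one_le_exp (-(x k / N k))
      simp only [hr]
      linarith
    refine hrt.frequently (Eventually.frequently ?_)
    have hkt : Tendsto (fun k : ℕ => (k : ℝ)) atTop atTop := tendsto_natCast_atTop_atTop
    filter_upwards [eventually_ge_atTop 1,
      hkt.eventually_ge_atTop (200 * M / η)] with k hk1 hk
    have hr0 : 0 < r k := Real.exp_pos _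
    have hrN : 1 ≤ N k * (1 - r k) := inv_le_one_sub_exp_neg_div (hx2 k) (hN2 k)
    have hnorm : ‖(r k : ℂ) * ζ‖ = r k := by
      rw [norm_mul, hζ, mul_one, Complex.norm_real, Real.norm_of_nonneg hr0.le]
    have hpow : ((r k : ℂ) * ζ) ^ 2 ^ k.factorial = Real.exp (-x k) * ζ ^ 2 ^ k.factorial := by
      rw [mul_pow, ← Complex.ofReal_pow, hr, ← Real.exp_nat_mul]
      congr 3
      have := (hN0 k).ne'
      simp only [hN] at this ⊢
      push_cast
      field_simp
    have hre := re_lacunary_ge hp hM (z := r k * ζ) (by rw [hnorm]; exact hr1 k) hk1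
      (by rw [hnorm]; exact hrN)
    rw [hpow] at hre
    have hlogle : |Real.log (1 - r k)| ≤ k.factorial := by
      have h1r : 0 < 1 - r k := by linarith [hr1 k]
      rw [abs_of_neg (Real.log_neg h1r (by linarith))]
      have := Real.log_nonneg hrN
      rw [Real.log_mul (hN0 k).ne' h1r.ne', hN, Real.log_pow] at this
      have : (k.factorial : ℝ) * Real.log 2 ≤ k.factorial :=
        mul_le_of_le_one_right (by positivity) (by linarith [Real.log_two_lt_d9])
      linarith
    have hlogpos : 0 < |Real.log (1 - r k)| :=
      abs_pos.2 (Real.log_neg (by linarith [hr1 k]) (by linarith)).ne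
    have hfac : (k.factorial : ℝ) = k * (k - 1).factorial := by
      exact_mod_cast (Nat.mul_factorial_pred (by omega)).symm
    have hfac1 : (1 : ℝ) ≤ (k - 1).factorial := by
      exact_mod_cast Nat.factorial_pos (k - 1)
    rw [div_le_iff₀ hη] at hk
    have hmain : η / 2 * k.factorial ≤ (lacunary p (r k * ζ)).re := by
      refine le_trans ?_ hre
      have h1 : k.factorial * η ≤ k.factorial *
          (p (Real.exp (-x k) * ζ ^ 2 ^ k.factorial)).re := by
        gcongr
        exact hxp k
      have h2 : 200 * M * (k - 1).factorial ≤ k.factorial * η := by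
        rw [hfac]
        nlinarith
      nlinarith
    rw [Complex.norm_exp, Real.log_exp, le_div_iff₀ hlogpos]
    exact le_trans (by gcongr) hmain
end
end

section
/- Let λ(t) = t·|log t|. There exists a function f in the Korenblum class A^{-∞} such that |f| is bounded from below on the unit disc by a positive constant and H_λ(D_+(f)) = ∞. -/
open Filter MeasureTheory

noncomputable section

/-- Hausdorff measure on `ℝ` with gauge function `lam`:
`H_lam(C) = lim_{ε→0} inf {Σ_s lam(|J_s|) : C ⊆ ⋃_s J_s, |J_s| < ε}`. -/
def hausdorffGauge (lam : ℝ → ℝ) : Measure ℝ :=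
  Measure.mkMetric fun d => ENNReal.ofReal (lam d.toReal)

/-- `D_+(f)`: the set of `θ ∈ [0, 2π)` such that
`liminf_{r→1⁻} log|f(re^{iθ})| / |log(1-r)| > 0`. -/
def Dplus (f : ℂ → ℂ) : Set ℝ :=
  {θ | θ ∈ Set.Ico 0 (2 * Real.pi) ∧
    ∃ c : ℝ, 0 < c ∧ ∀ᶠ r : ℝ in nhdsWithin 1 (Set.Iio 1),
      c ≤ Real.log ‖f ((r : ℂ) * Complex.exp (Complex.I * (θ : ℂ)))‖ / |Real.log (1 - r)|}


/-- The integer whose binary expansion is the first `n` digits of `d`. -/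
def digitPrefix (d : ℕ → Fin 2) : ℕ → ℕ
  | 0 => 0
  | n + 1 => 2 * digitPrefix d n + (d n : ℕ)

lemma digitPrefix_injective {d e : ℕ → Fin 2} {n : ℕ}
    (h : digitPrefix d n = digitPrefix e n) : ∀ i < n, d i = e i := by
  induction n with
  | zero => simp
  | succ n ih =>
    simp only [digitPrefix] at h
    have hd := (d n).isLt
    have he := (e n).isLt
    intro i hi
    rcases Nat.lt_succ_iff_lt_or_eq.1 hi with hi | rfl
    · exact ih (by omega) i hi
    · exact Fin.ext (by omega)

lemma sum_ofDigitsTerm_eq_digitPrefix (d : ℕ → Fin 2) (n : ℕ) :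
    ∑ i ∈ Finset.range n, Real.ofDigitsTerm d i = digitPrefix d n / 2 ^ n := by
  induction n with
  | zero => simp [digitPrefix]
  | succ n ih =>
    rw [Finset.sum_range_succ, ih, Real.ofDigitsTerm, digitPrefix]
    push_cast
    field_simp
    ring

lemma digitPrefix_div_le_ofDigits (d : ℕ → Fin 2) (n : ℕ) :
    digitPrefix d n / 2 ^ n ≤ Real.ofDigits d := by
  rw [Real.ofDigits_eq_sum_add_ofDigits d n, sum_ofDigitsTerm_eq_digitPrefix]
  have := Real.ofDigits_nonneg fun i => d (i + n)
  have : 0 ≤ ((2 : ℕ) ^ n : ℝ)⁻¹ * Real.ofDigits fun i => d (i + n) := by positivity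
  linarith

lemma ofDigits_le_digitPrefix_add_one_div (d : ℕ → Fin 2) (n : ℕ) :
    Real.ofDigits d ≤ (digitPrefix d n + 1) / 2 ^ n := by
  rw [Real.ofDigits_eq_sum_add_ofDigits d n, sum_ofDigitsTerm_eq_digitPrefix, add_div]
  have := Real.ofDigits_le_one fun i => d (i + n)
  have : ((2 : ℕ) ^ n : ℝ)⁻¹ * (Real.ofDigits fun i => d (i + n)) ≤ ((2 : ℕ) ^ n : ℝ)⁻¹ * 1 := by
    gcongr
  push_cast at this ⊢
  rw [one_div]
  linarith

/-- The sequence starting at `N` that doubles at step `n` whenever it would otherwise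
fall below `n + 1`. -/
def growth (N : ℕ) : ℕ → ℕ
  | 0 => N
  | n + 1 => if growth N n < n + 1 then 2 * growth N n else growth N n

lemma growth_pos {N : ℕ} (hN : 0 < N) (n : ℕ) : 0 < growth N n := by
  induction n with
  | zero => simpa [growth]
  | succ n ih => rw [growth]; split_ifs <;> omega

lemma le_growth {N : ℕ} (hN : 0 < N) (n : ℕ) : n ≤ growth N n := by
  induction n with
  | zero => simp
  | succ n ih =>
    have := growth_pos hN n
    rw [growth]; split_ifs <;> omega

lemma growth_le (N n : ℕ) : growth N n ≤ max N (2 * n) := by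
  induction n with
  | zero => simp [growth]
  | succ n ih => rw [growth]; split_ifs <;> omega

/-- The digits of `b`, set to `0` at the doubling times of `growth N`. -/
def mask (N : ℕ) (b : ℕ → Fin 2) (i : ℕ) : Fin 2 :=
  if growth N i < i + 1 then 0 else b i

/-- The law of a sequence of independent fair binary digits. -/
def coinMeasure : Measure (ℕ → Fin 2) :=
  Measure.infinitePi fun _ => (PMF.uniformOfFintype (Fin 2)).toMeasure

instance : IsProbabilityMeasure coinMeasure := by
  unfold coinMeasure; infer_instance

/-- The sequences agreeing with `b` at the unmasked places below `n`. -/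
def freeCylinder (N : ℕ) (b : ℕ → Fin 2) (n : ℕ) : Set (ℕ → Fin 2) :=
  Set.pi (Finset.range n) fun i => if growth N i < i + 1 then Set.univ else {b i}

lemma mem_freeCylinder {N n : ℕ} {b c : ℕ → Fin 2} :
    c ∈ freeCylinder N b n ↔ ∀ i < n, mask N c i = mask N b i := by
  simp only [freeCylinder, Set.mem_pi, Finset.coe_range, Set.mem_Iio, mask]
  refine forall₂_congr fun i _ => ?_
  split_ifs <;> simp

lemma coinMeasure_freeCylinder {N : ℕ} (hN : 0 < N) (b : ℕ → Fin 2) (n : ℕ) :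
    coinMeasure (freeCylinder N b n) = ENNReal.ofReal (growth N n / (N * 2 ^ n)) := by
  rw [coinMeasure, freeCylinder, Measure.infinitePi_pi _ fun i _ => MeasurableSet.of_discrete]
  have hN' : (N : ℝ) ≠ 0 := by positivity
  induction n with
  | zero => simp [growth, div_self hN']
  | succ n ih =>
    rw [Finset.prod_range_succ, ih, growth]
    split_ifs
    · rw [measure_univ, mul_one]
      congr 1
      push_cast
      field_simp
      ring
    · rw [PMF.toMeasure_apply_singleton _ _ (MeasurableSet.singleton _),
        PMF.uniformOfFintype_apply, Fintype.card_fin,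
        show ((2 : ℕ) : ENNReal)⁻¹ = ENNReal.ofReal 2⁻¹ by
          rw [ENNReal.ofReal_inv_of_pos two_pos]; simp,
        ← ENNReal.ofReal_mul (by positivity)]
      congr 1
      field_simp
      ring

/-- The real number with binary digits `mask N b`. -/
def maskedReal (N : ℕ) (b : ℕ → Fin 2) : ℝ := Real.ofDigits (mask N b)

lemma maskedReal_mem_Icc (N : ℕ) (b : ℕ → Fin 2) : maskedReal N b ∈ Set.Icc (0 : ℝ) 1 :=
  ⟨Real.ofDigits_nonneg _, Real.ofDigits_le_one _⟩

lemma measurable_maskedReal (N : ℕ) : Measurable (maskedReal N) := by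
  refine Continuous.measurable (Real.continuous_ofDigits.comp (continuous_pi fun i => ?_))
  unfold mask
  split_ifs <;> fun_prop

/-- The law of `maskedReal N`. -/
def cantorLaw (N : ℕ) : Measure ℝ := coinMeasure.map (maskedReal N)

instance (N : ℕ) : IsProbabilityMeasure (cantorLaw N) :=
  Measure.isProbabilityMeasure_map (measurable_maskedReal N).aemeasurable

lemma coinMeasure_digitPrefix_eq_le {N : ℕ} (hN : 0 < N) (n m : ℕ) :
    coinMeasure {b | digitPrefix (mask N b) n = m} ≤
      ENNReal.ofReal (growth N n / (N * 2 ^ n)) := by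
  rcases Set.eq_empty_or_nonempty {b | digitPrefix (mask N b) n = m} with h | ⟨b, hb⟩
  · simp [h]
  · rw [← coinMeasure_freeCylinder hN b n]
    refine measure_mono fun c hc => mem_freeCylinder.2 (digitPrefix_injective ?_)
    exact hc.trans hb.symm

lemma cantorLaw_Icc_le {N : ℕ} (hN : 0 < N) (n : ℕ) (a : ℝ) :
    cantorLaw N (Set.Icc a (a + (2 ^ n)⁻¹)) ≤
      ENNReal.ofReal (3 * (growth N n / (N * 2 ^ n))) := by
  set m := ⌈a * 2 ^ n - 1⌉₊
  rw [cantorLaw, Measure.map_apply (measurable_maskedReal N) measurableSet_Icc]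
  calc coinMeasure (maskedReal N ⁻¹' Set.Icc a (a + (2 ^ n)⁻¹))
      ≤ coinMeasure (⋃ k ∈ Finset.range 3, {b | digitPrefix (mask N b) n = m + k}) := by
        refine measure_mono fun b hb => ?_
        have h1 := digitPrefix_div_le_ofDigits (mask N b) n
        have h2 := ofDigits_le_digitPrefix_add_one_div (mask N b) n
        have h3 : a ≤ (digitPrefix (mask N b) n + 1) / 2 ^ n := hb.1.trans h2
        have h4 : (digitPrefix (mask N b) n : ℝ) / 2 ^ n ≤ a + (2 ^ n)⁻¹ := h1.trans hb.2
        rw [le_div_iff₀ (by positivity)] at h3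
        rw [div_le_iff₀ (by positivity), add_mul, inv_mul_cancel₀ (by positivity)] at h4
        have h5 : m ≤ digitPrefix (mask N b) n := Nat.ceil_le.2 (by linarith)
        have h6 : (digitPrefix (mask N b) n : ℝ) ≤ (m + 2 : ℕ) := by
          push_cast
          linarith [Nat.le_ceil (a * 2 ^ n - 1)]
        have h7 := Nat.cast_le.1 h6
        simp only [Set.mem_iUnion, Set.mem_ofPred_eq, Finset.mem_range, exists_prop]
        exact ⟨digitPrefix (mask N b) n - m, by omega, by omega⟩
    _ ≤ ∑ k ∈ Finset.range 3, ENNReal.ofReal (growth N n / (N * 2 ^ n)) :=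
        (measure_biUnion_finset_le _ _).trans
          (Finset.sum_le_sum fun k _ => coinMeasure_digitPrefix_eq_le hN n _)
    _ = _ := by
        rw [Finset.sum_const, Finset.card_range, ENNReal.ofReal_mul (by norm_num),
          nsmul_eq_mul]
        simp

lemma le_cantorLaw_Icc {N : ℕ} (hN : 0 < N) (n : ℕ) (b : ℕ → Fin 2) :
    ENNReal.ofReal (growth N n / (N * 2 ^ n)) ≤
      cantorLaw N (Set.Icc (maskedReal N b - (2 ^ n)⁻¹) (maskedReal N b + (2 ^ n)⁻¹)) := by
  rw [cantorLaw, Measure.map_apply (measurable_maskedReal N) measurableSet_Icc,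
    ← coinMeasure_freeCylinder hN b n]
  refine measure_mono fun c hc => ?_
  have := Real.abs_ofDigits_sub_ofDigits_le (mem_freeCylinder.1 hc)
  rw [abs_le] at this
  push_cast at this
  constructor <;> simp only [maskedReal] <;> linarith

lemma exists_subset_Icc_of_abs_sub_le {s : Set ℝ} {δ : ℝ}
    (h : ∀ x ∈ s, ∀ y ∈ s, |x - y| ≤ δ) : ∃ a, s ⊆ Set.Icc a (a + δ) := by
  rcases s.eq_empty_or_nonempty with rfl | ⟨x₀, hx₀⟩
  · exact ⟨0, Set.empty_subset _⟩
  have hb : BddBelow s := ⟨x₀ - δ, fun y hy => by linarith [(abs_le.1 (h x₀ hx₀ y hy)).2]⟩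
  refine ⟨sInf s, fun x hx => ⟨csInf_le hb hx, ?_⟩⟩
  have : x - δ ≤ sInf s :=
    le_csInf ⟨x₀, hx₀⟩ fun y hy => by linarith [(abs_le.1 (h x hx y hy)).2]
  linarith

lemma exists_inv_two_pow_succ_lt_le {d : ℝ} (hd : 0 < d) (hd1 : d ≤ 1) :
    ∃ n : ℕ, (2 ^ (n + 1))⁻¹ < d ∧ d ≤ (2 ^ n : ℝ)⁻¹ := by
  obtain ⟨n, h1, h2⟩ := exists_nat_pow_near_of_lt_one hd hd1
    (show (0 : ℝ) < 2⁻¹ by norm_num) (by norm_num)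
  exact ⟨n, by simpa using h1, by simpa using h2⟩

lemma natCast_div_two_le_abs_log {d : ℝ} {n : ℕ} (hd : 0 < d) (hn : d ≤ (2 ^ n : ℝ)⁻¹) :
    (n : ℝ) / 2 ≤ |Real.log d| := by
  have h1 := Real.log_le_log hd hn
  rw [Real.log_inv, Real.log_pow] at h1
  have h2 := Real.log_two_gt_d9
  have h3 : (n : ℝ) * (1 / 2) ≤ n * Real.log 2 := by gcongr; linarith
  linarith [neg_le_abs (Real.log d)]

lemma cantorLaw_le_of_ediam_le {N : ℕ} (hN : 0 < N) {s : Set ℝ}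
    (hs : Metric.ediam s ≤ ENNReal.ofReal (2 ^ (N + 1))⁻¹) :
    cantorLaw N s ≤ ENNReal.ofReal (24 / N) *
      ENNReal.ofReal ((Metric.ediam s).toReal * |Real.log (Metric.ediam s).toReal|) := by
  have hfin : Metric.ediam s ≠ ⊤ := ne_top_of_le_ne_top ENNReal.ofReal_ne_top hs
  set d := (Metric.ediam s).toReal with hd
  have hdN : d ≤ (2 ^ (N + 1))⁻¹ := ENNReal.toReal_le_of_le_ofReal (by positivity) hs
  have hdist : ∀ x ∈ s, ∀ y ∈ s, |x - y| ≤ d := fun x hx y hy => by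
    rw [← Real.dist_eq, dist_edist]
    exact ENNReal.toReal_mono hfin (Metric.edist_le_ediam_of_mem hx hy)
  have key : ∀ n : ℕ, N ≤ n → d ≤ (2 ^ n)⁻¹ →
      cantorLaw N s ≤ ENNReal.ofReal (6 / N * (n / 2 ^ n)) := fun n hNn hdn => by
    obtain ⟨a, ha⟩ := exists_subset_Icc_of_abs_sub_le
      fun x hx y hy => (hdist x hx y hy).trans hdn
    refine (measure_mono ha).trans ((cantorLaw_Icc_le hN n a).trans ?_)
    refine ENNReal.ofReal_le_ofReal ?_
    have hg : growth N n ≤ 2 * n := (growth_le N n).trans (by omega)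
    have hg' : (growth N n : ℝ) ≤ 2 * n := by exact_mod_cast hg
    calc 3 * (growth N n / (N * 2 ^ n)) ≤ 3 * (2 * n / (N * 2 ^ n) : ℝ) := by gcongr
      _ = _ := by field_simp; ring
  have hd0 : 0 ≤ d := ENNReal.toReal_nonneg
  rcases hd0.eq_or_lt with h0 | hpos
  · rw [← h0] at key ⊢
    simp only [zero_mul, ENNReal.ofReal_zero, mul_zero]
    have hlim : Tendsto (fun n : ℕ => ENNReal.ofReal (6 / N * (n / 2 ^ n)))
        atTop (nhds (ENNReal.ofReal (6 / N * 0))) := by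
      refine ENNReal.tendsto_ofReal (Tendsto.const_mul _ ?_)
      simpa using tendsto_pow_const_div_const_pow_of_one_lt 1 (one_lt_two (α := ℝ))
    rw [mul_zero, ENNReal.ofReal_zero] at hlim
    exact ge_of_tendsto hlim
      ((eventually_ge_atTop N).mono fun n hn => key n hn (by positivity))
  · obtain ⟨n, hn1, hn2⟩ := exists_inv_two_pow_succ_lt_le hpos
      (hdN.trans (inv_le_one_of_one_le₀ (one_le_pow₀ one_le_two)))
    have hNn : N ≤ n := by
      have := hn1.trans_le hdN
      rw [inv_lt_inv₀ (by positivity) (by positivity), pow_lt_pow_iff_right₀ one_lt_two] at this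
      omega
    refine (key n hNn hn2).trans ?_
    rw [← ENNReal.ofReal_mul (by positivity)]
    refine ENNReal.ofReal_le_ofReal ?_
    have hlog := natCast_div_two_le_abs_log hpos hn2
    have h2 : ((2 : ℝ) ^ n)⁻¹ ≤ 2 * d := by
      rw [pow_succ, mul_inv] at hn1
      linarith
    calc 6 / (N : ℝ) * (n / 2 ^ n) = 24 / N * ((2 ^ n)⁻¹ / 2 * (n / 2)) := by
          field_simp; ring
      _ ≤ 24 / N * (d * |Real.log d|) := by
          gcongr
          linarith

lemma ofReal_le_hausdorffGauge {N : ℕ} (hN : 0 < N) {E : Set ℝ}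
    (hE : Set.range (maskedReal N) ⊆ E) :
    ENNReal.ofReal (N / 24) ≤ hausdorffGauge (fun t => t * |Real.log t|) E := by
  have hle : ENNReal.ofReal (N / 24) • cantorLaw N ≤
      hausdorffGauge (fun t => t * |Real.log t|) := by
    refine Measure.le_mkMetric _ _ (ENNReal.ofReal (2 ^ (N + 1))⁻¹)
      (ENNReal.ofReal_pos.2 (by positivity)) fun s hs => ?_
    rw [Measure.smul_apply, smul_eq_mul]
    refine (mul_le_mul_right (cantorLaw_le_of_ediam_le hN hs) _).trans_eq ?_
    rw [← mul_assoc, ← ENNReal.ofReal_mul (by positivity)]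
    have : (N : ℝ) / 24 * (24 / N) = 1 := by field_simp
    rw [this, ENNReal.ofReal_one, one_mul]
  refine le_trans ?_ (hle E)
  have h1 : 1 ≤ cantorLaw N E := by
    refine le_trans ?_ (Measure.le_map_apply (measurable_maskedReal N).aemeasurable E)
    rw [Set.preimage_eq_univ_iff.2 hE, measure_univ]
  rw [Measure.smul_apply, smul_eq_mul]
  exact le_mul_of_one_le_right' h1

/-- A probability measure on `[0, 1]` which is small on short intervals but charges all small
intervals around the points of a set of infinite `t |log t|`-Hausdorff measure. -/
def cantorMixture : Measure ℝ :=
  Measure.sum fun N : ℕ => (2⁻¹ : ENNReal) ^ (N + 1) • cantorLaw (N + 1)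

lemma cantorMixture_le {s : Set ℝ} (hs : MeasurableSet s) {M : ENNReal}
    (h : ∀ N, cantorLaw (N + 1) s ≤ M) : cantorMixture s ≤ M := by
  rw [cantorMixture, Measure.sum_apply _ hs]
  calc ∑' N : ℕ, ((2⁻¹ : ENNReal) ^ (N + 1) • cantorLaw (N + 1)) s
      ≤ ∑' N : ℕ, (2⁻¹ : ENNReal) ^ (N + 1) * M :=
        ENNReal.tsum_le_tsum fun N => mul_le_mul_right (h N) _
    _ = M := by
        rw [ENNReal.tsum_mul_right]
        simp [ENNReal.tsum_geometric_add_one, ENNReal.inv_mul_cancel]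

instance : IsFiniteMeasure cantorMixture :=
  ⟨(cantorMixture_le MeasurableSet.univ fun _ => prob_le_one).trans_lt ENNReal.one_lt_top⟩

lemma cantorMixture_univ_le : cantorMixture Set.univ ≤ 1 :=
  cantorMixture_le MeasurableSet.univ fun _ => prob_le_one

lemma ae_cantorMixture_mem_Icc : ∀ᵐ x ∂cantorMixture, x ∈ Set.Icc (0 : ℝ) 1 := by
  rw [ae_iff]
  refine le_antisymm (cantorMixture_le measurableSet_Icc.compl fun N => ?_) zero_le
  rw [cantorLaw, Measure.map_apply (measurable_maskedReal _) measurableSet_Icc.compl]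
  simp [Set.preimage_compl, Set.preimage_eq_univ_iff.2
    (Set.range_subset_iff.2 (maskedReal_mem_Icc (N + 1)))]

lemma cantorMixture_Icc_le (n : ℕ) (a : ℝ) :
    cantorMixture (Set.Icc a (a + (2 ^ n)⁻¹)) ≤ ENNReal.ofReal (6 * (n + 1) / 2 ^ n) := by
  refine cantorMixture_le measurableSet_Icc fun N =>
    (cantorLaw_Icc_le N.succ_pos n a).trans (ENNReal.ofReal_le_ofReal ?_)
  have hg : growth (N + 1) n ≤ (N + 1) * (2 * (n + 1)) :=
    (growth_le _ n).trans (max_le (by nlinarith) (by nlinarith))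
  have hg' : (growth (N + 1) n : ℝ) ≤ (N + 1 : ℕ) * (2 * (n + 1)) := by exact_mod_cast hg
  calc 3 * (growth (N + 1) n / ((N + 1 : ℕ) * 2 ^ n))
      ≤ 3 * ((N + 1 : ℕ) * (2 * (n + 1)) / ((N + 1 : ℕ) * 2 ^ n) : ℝ) := by gcongr
    _ = _ := by field_simp; norm_num

lemma exists_le_cantorMixture_Icc (N : ℕ) (b : ℕ → Fin 2) :
    ∃ c : ℝ, 0 < c ∧ ∀ n : ℕ, ENNReal.ofReal (c * (n / 2 ^ n)) ≤ cantorMixture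
      (Set.Icc (maskedReal (N + 1) b - (2 ^ n)⁻¹) (maskedReal (N + 1) b + (2 ^ n)⁻¹)) := by
  refine ⟨2⁻¹ ^ (N + 1) / (N + 1 : ℕ), by positivity, fun n => ?_⟩
  rw [cantorMixture, Measure.sum_apply _ measurableSet_Icc]
  refine le_trans ?_ (ENNReal.le_tsum N)
  rw [Measure.smul_apply, smul_eq_mul]
  refine le_trans ?_ (mul_le_mul_right (le_cantorLaw_Icc N.succ_pos n b) _)
  rw [show (2⁻¹ : ENNReal) = ENNReal.ofReal 2⁻¹ by
    rw [ENNReal.ofReal_inv_of_pos two_pos]; simp, ← ENNReal.ofReal_pow (by positivity),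
    ← ENNReal.ofReal_mul (by positivity)]
  refine ENNReal.ofReal_le_ofReal ?_
  have hg : (n : ℝ) ≤ growth (N + 1) n := by exact_mod_cast le_growth N.succ_pos n
  calc (2⁻¹ : ℝ) ^ (N + 1) / (N + 1 : ℕ) * (n / 2 ^ n)
      = 2⁻¹ ^ (N + 1) * (n / ((N + 1 : ℕ) * 2 ^ n)) := by field_simp
    _ ≤ _ := by gcongr

lemma norm_exp_I_mul_sub (x y : ℝ) :
    ‖Complex.exp (Complex.I * x) - Complex.exp (Complex.I * y)‖ =
      ‖Complex.exp (Complex.I * (x - y : ℝ)) - 1‖ := by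
  have h : Complex.exp (Complex.I * x) - Complex.exp (Complex.I * y) =
      Complex.exp (Complex.I * y) * (Complex.exp (Complex.I * (x - y : ℝ)) - 1) := by
    rw [mul_sub, mul_one, ← Complex.exp_add]
    congr 2
    push_cast
    ring
  rw [h, norm_mul, Complex.norm_exp_I_mul_ofReal, one_mul]

lemma norm_exp_I_mul_sub_le (x y : ℝ) :
    ‖Complex.exp (Complex.I * x) - Complex.exp (Complex.I * y)‖ ≤ |x - y| := by
  rw [norm_exp_I_mul_sub]
  exact Real.norm_exp_I_mul_ofReal_sub_one_le

lemma abs_sub_le_two_mul_norm_exp_I_mul_sub {x y : ℝ} (h : |x - y| ≤ 1) :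
    |x - y| ≤ 2 * ‖Complex.exp (Complex.I * x) - Complex.exp (Complex.I * y)‖ := by
  rw [norm_exp_I_mul_sub,
    Complex.norm_exp_I_mul_ofReal_sub_one, norm_mul, Real.norm_eq_abs, Real.norm_eq_abs,
    abs_of_pos (two_pos : (0 : ℝ) < 2)]
  have hs := Real.mul_abs_le_abs_sin (x := (x - y) / 2) (by
    rw [abs_div, abs_of_pos (two_pos : (0 : ℝ) < 2)]
    linarith [Real.pi_gt_three])
  have hpi : (1 : ℝ) / 2 ≤ 2 / Real.pi := by
    rw [div_le_div_iff₀ two_pos Real.pi_pos]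
    linarith [Real.pi_le_four]
  rw [abs_div, abs_of_pos (two_pos : (0 : ℝ) < 2)] at hs
  have := mul_le_mul_of_nonneg_right hpi (by positivity : 0 ≤ |x - y| / 2)
  linarith

/-- The Herglotz integral of a measure on `ℝ`, transported to the circle. -/
def herglotzIntegral (μ : Measure ℝ) (z : ℂ) : ℂ :=
  ∫ x, (Complex.exp (Complex.I * (x : ℝ)) + z) / (Complex.exp (Complex.I * (x : ℝ)) - z) ∂μ

section Herglotz

variable {μ : Measure ℝ} [IsFiniteMeasure μ] {z : ℂ}

lemma one_sub_norm_le (z : ℂ) (x : ℝ) :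
    1 - ‖z‖ ≤ ‖Complex.exp (Complex.I * x) - z‖ := by
  simpa [Complex.norm_exp_I_mul_ofReal] using norm_sub_norm_le (Complex.exp (Complex.I * x)) z

lemma exp_I_mul_sub_ne_zero (hz : ‖z‖ < 1) (x : ℝ) : Complex.exp (Complex.I * x) - z ≠ 0 :=
  norm_pos_iff.1 ((sub_pos.2 hz).trans_le (one_sub_norm_le z x))

lemma continuous_herglotz (hz : ‖z‖ < 1) : Continuous fun x : ℝ =>
    (Complex.exp (Complex.I * x) + z) / (Complex.exp (Complex.I * x) - z) :=
  Continuous.div (by fun_prop) (by fun_prop) (exp_I_mul_sub_ne_zero hz)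

lemma integrable_herglotz (hz : ‖z‖ < 1) : Integrable (fun x : ℝ =>
    (Complex.exp (Complex.I * x) + z) / (Complex.exp (Complex.I * x) - z)) μ := by
  refine Integrable.of_bound (continuous_herglotz hz).aestronglyMeasurable (2 / (1 - ‖z‖))
    (ae_of_all _ fun x => ?_)
  have h1 := one_sub_norm_le z x
  have h2 : ‖Complex.exp (Complex.I * x) + z‖ ≤ 2 := by
    refine (norm_add_le _ _).trans ?_
    rw [Complex.norm_exp_I_mul_ofReal]
    linarith
  rw [norm_div]
  have := sub_pos.2 hz
  gcongr

lemma re_herglotz (z : ℂ) (x : ℝ) :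
    ((Complex.exp (Complex.I * x) + z) / (Complex.exp (Complex.I * x) - z)).re =
      (1 - ‖z‖ ^ 2) / ‖Complex.exp (Complex.I * x) - z‖ ^ 2 := by
  have := congrFun (poissonKernel_eq_re_herglotzRieszKernel (c := 0) (w := z))
    (Complex.exp (Complex.I * x))
  simpa [poissonKernel, herglotzRieszKernel, Complex.norm_exp_I_mul_ofReal] using this.symm

lemma integrable_poisson (hz : ‖z‖ < 1) : Integrable (fun x : ℝ =>
    (1 - ‖z‖ ^ 2) / ‖Complex.exp (Complex.I * x) - z‖ ^ 2) μ :=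
  (integrable_herglotz hz).re.congr (ae_of_all _ (re_herglotz z))

lemma re_herglotzIntegral (hz : ‖z‖ < 1) : (herglotzIntegral μ z).re =
    ∫ x : ℝ, (1 - ‖z‖ ^ 2) / ‖Complex.exp (Complex.I * x) - z‖ ^ 2 ∂μ := by
  simp_rw [← re_herglotz]
  exact (integral_re (integrable_herglotz hz)).symm

lemma re_herglotzIntegral_nonneg (hz : ‖z‖ < 1) : 0 ≤ (herglotzIntegral μ z).re := by
  rw [re_herglotzIntegral hz]
  refine integral_nonneg fun x => div_nonneg ?_ (by positivity)
  nlinarith [norm_nonneg z]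

lemma differentiableOn_herglotzIntegral :
    DifferentiableOn ℂ (herglotzIntegral μ) (Metric.ball 0 1) := by
  intro z hz
  rw [mem_ball_zero_iff] at hz
  set ρ := (1 - ‖z‖) / 2 with hρ
  have hρ0 : 0 < ρ := by linarith
  have hball : ∀ w ∈ Metric.ball z ρ, ‖w‖ < 1 ∧ ρ ≤ 1 - ‖w‖ := fun w hw => by
    rw [mem_ball_iff_norm] at hw
    have := norm_sub_norm_le w z
    constructor <;> linarith
  refine (hasDerivAt_integral_of_dominated_loc_of_deriv_le
    (F' := fun w (x : ℝ) => 2 * Complex.exp (Complex.I * x) / (Complex.exp (Complex.I * x) - w) ^ 2)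
    (bound := fun _ => 2 / ρ ^ 2) (Metric.ball_mem_nhds z hρ0) ?_ (integrable_herglotz hz) ?_ ?_
    (integrable_const _) ?_).2.differentiableAt.differentiableWithinAt
  · filter_upwards [Metric.ball_mem_nhds z hρ0] with w hw
    exact (continuous_herglotz (hball w hw).1).aestronglyMeasurable
  · exact (Continuous.div (by fun_prop) (by fun_prop)
      fun x => pow_ne_zero 2 (exp_I_mul_sub_ne_zero hz x)).aestronglyMeasurable
  · refine ae_of_all _ fun x w hw => ?_
    have := (hball w hw).2.trans (one_sub_norm_le w x)
    rw [norm_div, norm_mul, norm_pow, Complex.norm_exp_I_mul_ofReal, Complex.norm_ofNat, mul_one]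
    gcongr
  · refine ae_of_all _ fun x w hw => ?_
    have h := ((hasDerivAt_id w).const_add (Complex.exp (Complex.I * x))).div
      ((hasDerivAt_id w).const_sub (Complex.exp (Complex.I * x)))
      (exp_I_mul_sub_ne_zero (hball w hw).1 x)
    refine h.congr_deriv ?_
    simp only [id_eq]
    ring

lemma le_re_herglotzIntegral {r x₀ : ℝ} {n : ℕ} (hr : 0 ≤ r) (h1 : (2 ^ (n + 1))⁻¹ < 1 - r)
    (h2 : 1 - r ≤ (2 ^ n)⁻¹) :
    2 ^ n / 4 * μ.real (Set.Icc (x₀ - (2 ^ (n + 1))⁻¹) (x₀ + (2 ^ (n + 1))⁻¹)) ≤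
      (herglotzIntegral μ (r * Complex.exp (Complex.I * x₀))).re := by
  have hr1 : r < 1 := by linarith [show (0 : ℝ) < (2 ^ (n + 1))⁻¹ by positivity]
  have hnorm : ‖r * Complex.exp (Complex.I * x₀)‖ = r := by
    rw [norm_mul, Complex.norm_exp_I_mul_ofReal, mul_one, Complex.norm_real,
      Real.norm_of_nonneg hr]
  have hz : ‖r * Complex.exp (Complex.I * x₀)‖ < 1 := hnorm.trans_lt hr1
  rw [re_herglotzIntegral hz, mul_comm, ← smul_eq_mul, ← integral_indicator_const _ measurableSet_Icc]
  refine integral_mono ((integrable_const _).indicator measurableSet_Icc)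
    (integrable_poisson hz) fun x => ?_
  dsimp only
  refine Set.indicator_apply_le' (fun hx => ?_) (fun _ => ?_)
  · have hd : ‖Complex.exp (Complex.I * x) - r * Complex.exp (Complex.I * x₀)‖ ≤ 2 * (1 - r) := by
      have e : Complex.exp (Complex.I * x) - r * Complex.exp (Complex.I * x₀) =
          (Complex.exp (Complex.I * x) - Complex.exp (Complex.I * x₀)) +
            (1 - r : ℝ) * Complex.exp (Complex.I * x₀) := by
        push_cast
        ring
      have h3 : |x - x₀| ≤ 1 - r := by
        rw [abs_le]
        constructor <;> linarith [hx.1, hx.2]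
      rw [e]
      refine (norm_add_le _ _).trans ?_
      rw [norm_mul, Complex.norm_exp_I_mul_ofReal, Complex.norm_real,
        Real.norm_of_nonneg (by linarith : 0 ≤ 1 - r)]
      linarith [norm_exp_I_mul_sub_le x x₀]
    have hd0 : 0 < ‖Complex.exp (Complex.I * x) - r * Complex.exp (Complex.I * x₀)‖ :=
      norm_pos_iff.2 (exp_I_mul_sub_ne_zero hz x)
    have h3 : 2 ^ n * (1 - r) ≤ 1 := by
      have := mul_le_mul_of_nonneg_left h2 (by positivity : (0 : ℝ) ≤ 2 ^ n)
      rwa [mul_inv_cancel₀ (by positivity)] at this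
    rw [hnorm, le_div_iff₀ (by positivity)]
    calc 2 ^ n / 4 * ‖Complex.exp (Complex.I * x) - r * Complex.exp (Complex.I * x₀)‖ ^ 2
        ≤ 2 ^ n / 4 * (2 * (1 - r)) ^ 2 := by gcongr
      _ = 2 ^ n * (1 - r) * (1 - r) := by ring
      _ ≤ 1 * (1 - r) := by
        gcongr
      _ ≤ 1 - r ^ 2 := by nlinarith
  · refine div_nonneg ?_ (by positivity)
    rw [hnorm]
    nlinarith

end Herglotz

/-- The points of `[0, 1]` whose image on the circle is within `2⁻ʲ` of `z`. -/
def circleNear (z : ℂ) (j : ℕ) : Set ℝ :=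
  Set.Icc 0 1 ∩ {x : ℝ | ‖Complex.exp (Complex.I * x) - z‖ ≤ (2 ^ j)⁻¹}

lemma measurableSet_circleNear (z : ℂ) (j : ℕ) : MeasurableSet (circleNear z j) :=
  measurableSet_Icc.inter
    (measurableSet_le (by fun_prop : Continuous _).measurable measurable_const)

lemma inv_norm_sq_le {z : ℂ} {x : ℝ} {n : ℕ} (hx : x ∈ Set.Icc (0 : ℝ) 1)
    (h : (2 ^ (n + 1))⁻¹ < ‖Complex.exp (Complex.I * x) - z‖) :
    (‖Complex.exp (Complex.I * x) - z‖ ^ 2)⁻¹ ≤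
      1 + ∑ j ∈ Finset.range (n + 1), (circleNear z j).indicator (fun _ => (4 : ℝ) ^ (j + 1)) x := by
  set d := ‖Complex.exp (Complex.I * x) - z‖ with hd
  have hd0 : 0 < d := lt_trans (by positivity) h
  have hnn : ∀ j ∈ Finset.range (n + 1),
      0 ≤ (circleNear z j).indicator (fun _ => (4 : ℝ) ^ (j + 1)) x := fun j _ =>
    Set.indicator_nonneg (fun _ _ => by positivity) _
  rcases le_total 1 d with h1 | h1
  · have : (d ^ 2)⁻¹ ≤ 1 := inv_le_one_of_one_le₀ (one_le_pow₀ h1)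
    linarith [Finset.sum_nonneg hnn]
  · obtain ⟨j, hj1, hj2⟩ := exists_inv_two_pow_succ_lt_le hd0 h1
    have hjn : j ∈ Finset.range (n + 1) := by
      have := h.trans_le hj2
      rw [inv_lt_inv₀ (by positivity) (by positivity), pow_lt_pow_iff_right₀ one_lt_two] at this
      exact Finset.mem_range.2 this
    have hle := Finset.single_le_sum hnn hjn
    rw [Set.indicator_of_mem (show x ∈ circleNear z j from ⟨hx, hj2⟩)] at hle
    have : (d ^ 2)⁻¹ ≤ 4 ^ (j + 1) := by
      have h4 : ((2 ^ (j + 1))⁻¹ : ℝ) ^ 2 ≤ d ^ 2 := by gcongr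
      rw [show (4 : ℝ) ^ (j + 1) = (((2 ^ (j + 1))⁻¹ : ℝ) ^ 2)⁻¹ by
        rw [inv_pow, inv_inv, ← pow_mul, mul_comm (j + 1), pow_mul]; norm_num]
      gcongr
    linarith

lemma cantorMixture_real_circleNear_le (z : ℂ) (j : ℕ) :
    cantorMixture.real (circleNear z j) ≤ 24 * (j + 1) / 2 ^ j := by
  refine ENNReal.toReal_le_of_le_ofReal (by positivity) ?_
  rcases lt_or_ge j 2 with hj | hj
  · refine (measure_mono (Set.subset_univ _)).trans (cantorMixture_univ_le.trans ?_)
    rw [ENNReal.one_le_ofReal]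
    interval_cases j <;> norm_num
  · obtain ⟨k, rfl⟩ := Nat.exists_eq_add_of_le' hj
    have hdist : ∀ x ∈ circleNear z (k + 2), ∀ y ∈ circleNear z (k + 2),
        |x - y| ≤ (2 ^ k)⁻¹ := fun x hx y hy => by
      have h1 : |x - y| ≤ 1 := by
        rw [abs_le]
        constructor <;> linarith [hx.1.1, hx.1.2, hy.1.1, hy.1.2]
      have h2 : ‖Complex.exp (Complex.I * x) - z‖ ≤ (2 ^ (k + 2))⁻¹ := hx.2
      have h3 : ‖Complex.exp (Complex.I * y) - z‖ ≤ (2 ^ (k + 2))⁻¹ := hy.2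
      rw [pow_add, mul_inv] at h2 h3
      have h4 := norm_sub_le_norm_sub_add_norm_sub (Complex.exp (Complex.I * x)) z
        (Complex.exp (Complex.I * y))
      rw [norm_sub_rev z] at h4
      linarith [abs_sub_le_two_mul_norm_exp_I_mul_sub h1]
    obtain ⟨a, ha⟩ := exists_subset_Icc_of_abs_sub_le hdist
    refine (measure_mono ha).trans ((cantorMixture_Icc_le k a).trans ?_)
    refine ENNReal.ofReal_le_ofReal ?_
    rw [div_le_div_iff₀ (by positivity) (by positivity), pow_add]
    push_cast
    nlinarith [show (0 : ℝ) < 2 ^ k by positivity]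

lemma re_herglotzIntegral_cantorMixture_le {z : ℂ} {n : ℕ} (h1 : (2 ^ (n + 1))⁻¹ < 1 - ‖z‖)
    (h2 : 1 - ‖z‖ ≤ (2 ^ n)⁻¹) :
    (herglotzIntegral cantorMixture z).re ≤ 386 + 384 * n := by
  have hz : ‖z‖ < 1 := by linarith [show (0 : ℝ) < (2 ^ (n + 1))⁻¹ by positivity]
  have hint : ∀ j ∈ Finset.range (n + 1), Integrable
      (fun x => (circleNear z j).indicator (fun _ => (4 : ℝ) ^ (j + 1)) x) cantorMixture :=
    fun j _ => (integrable_const _).indicator (measurableSet_circleNear z j)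
  have hq : 0 ≤ 1 - ‖z‖ ^ 2 := by nlinarith [norm_nonneg z]
  have hsum : ∑ j ∈ Finset.range (n + 1), 4 ^ (j + 1) * cantorMixture.real (circleNear z j) ≤
      192 * (n + 1) * 2 ^ n := by
    calc ∑ j ∈ Finset.range (n + 1), 4 ^ (j + 1) * cantorMixture.real (circleNear z j)
        ≤ ∑ j ∈ Finset.range (n + 1), 96 * ((n : ℝ) + 1) * 2 ^ j := by
          refine Finset.sum_le_sum fun j hj => ?_
          have hjn : (j : ℝ) ≤ n := by exact_mod_cast Nat.lt_succ_iff.1 (Finset.mem_range.1 hj)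
          calc 4 ^ (j + 1) * cantorMixture.real (circleNear z j)
              ≤ 4 ^ (j + 1) * (24 * (n + 1) / 2 ^ j) := by
                gcongr
                refine (cantorMixture_real_circleNear_le z j).trans ?_
                gcongr
            _ = 96 * ((n : ℝ) + 1) * 2 ^ j := by
                rw [pow_succ, show (4 : ℝ) ^ j = 2 ^ j * 2 ^ j by rw [← mul_pow]; norm_num]
                field_simp
                norm_num
      _ = 96 * ((n : ℝ) + 1) * (2 ^ (n + 1) - 1) := by
          rw [← Finset.mul_sum, geom_sum_eq (by norm_num)]
          norm_num
      _ ≤ 192 * (n + 1) * 2 ^ n := by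
          rw [pow_succ]
          nlinarith
  have huniv : cantorMixture.real Set.univ ≤ 1 :=
    ENNReal.toReal_le_of_le_ofReal zero_le_one (by simpa using cantorMixture_univ_le)
  rw [re_herglotzIntegral hz]
  calc ∫ x : ℝ, (1 - ‖z‖ ^ 2) / ‖Complex.exp (Complex.I * x) - z‖ ^ 2 ∂cantorMixture
      ≤ ∫ x : ℝ, (1 - ‖z‖ ^ 2) * (1 + ∑ j ∈ Finset.range (n + 1),
          (circleNear z j).indicator (fun _ => (4 : ℝ) ^ (j + 1)) x) ∂cantorMixture := by
        refine integral_mono_ae (integrable_poisson hz)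
          (((integrable_const _).add (integrable_finsetSum _ hint)).const_mul _) ?_
        filter_upwards [ae_cantorMixture_mem_Icc] with x hx
        rw [div_eq_mul_inv]
        exact mul_le_mul_of_nonneg_left
          (inv_norm_sq_le hx (h1.trans_le (one_sub_norm_le z x))) hq
    _ = (1 - ‖z‖ ^ 2) * (cantorMixture.real Set.univ +
          ∑ j ∈ Finset.range (n + 1), 4 ^ (j + 1) * cantorMixture.real (circleNear z j)) := by
        rw [integral_const_mul, integral_add (integrable_const _) (integrable_finsetSum _ hint),
          integral_finsetSum _ hint]
        simp only [integral_const, smul_eq_mul, one_mul,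
          integral_indicator_const _ (measurableSet_circleNear z _), mul_comm]
    _ ≤ (1 - ‖z‖ ^ 2) * (1 + 192 * (n + 1) * 2 ^ n) := by gcongr
    _ ≤ (2 * (2 ^ n)⁻¹) * (1 + 192 * (n + 1) * 2 ^ n) := by
        gcongr
        nlinarith [norm_nonneg z]
    _ = 2 * (2 ^ n)⁻¹ + 384 * (n + 1) := by
        field_simp
        ring
    _ ≤ 386 + 384 * n := by
        have : ((2 : ℝ) ^ n)⁻¹ ≤ 1 := inv_le_one_of_one_le₀ (one_le_pow₀ one_le_two)
        linarith

lemma korenblum_exp_herglotzIntegral_cantorMixture :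
    Korenblum fun z => Complex.exp (herglotzIntegral cantorMixture z) := by
  refine ⟨differentiableOn_herglotzIntegral.cexp, Real.exp 386, 768, Real.exp_pos _,
    by norm_num, fun z hz => ?_⟩
  rw [mem_ball_zero_iff] at hz
  have hpos : 0 < 1 - ‖z‖ := sub_pos.2 hz
  obtain ⟨n, h1, h2⟩ := exists_inv_two_pow_succ_lt_le hpos (by linarith [norm_nonneg z])
  have hlog := natCast_div_two_le_abs_log hpos h2
  rw [abs_of_nonpos (Real.log_nonpos hpos.le (by linarith [norm_nonneg z]))] at hlog
  rw [Complex.norm_exp, Real.rpow_def_of_pos hpos, ← Real.exp_sub, Real.exp_le_exp]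
  linarith [re_herglotzIntegral_cantorMixture_le h1 h2]

lemma maskedReal_mem_Dplus (N : ℕ) (b : ℕ → Fin 2) :
    maskedReal (N + 1) b ∈ Dplus fun z => Complex.exp (herglotzIntegral cantorMixture z) := by
  have hmem := maskedReal_mem_Icc (N + 1) b
  refine ⟨⟨hmem.1, hmem.2.trans_lt (by linarith [Real.pi_gt_three])⟩, ?_⟩
  obtain ⟨c, hc, hμ⟩ := exists_le_cantorMixture_Icc N b
  refine ⟨c / 8, by positivity, ?_⟩
  filter_upwards [Ioo_mem_nhdsLT (zero_lt_one (α := ℝ))] with r hr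
  have hpos : 0 < 1 - r := sub_pos.2 hr.2
  obtain ⟨n, h1, h2⟩ := exists_inv_two_pow_succ_lt_le hpos (by linarith [hr.1])
  have hneg : Real.log (1 - r) < 0 := Real.log_neg hpos (by linarith [hr.1])
  have hlog : -Real.log (1 - r) ≤ n + 1 := by
    have h3 := Real.log_le_log (by positivity) h1.le
    rw [Real.log_inv, Real.log_pow] at h3
    push_cast at h3
    have h4 : ((n : ℝ) + 1) * Real.log 2 ≤ (n + 1) * 1 := by
      gcongr
      linarith [Real.log_two_lt_d9]
    linarith
  have hm : c * ((n + 1 : ℕ) / 2 ^ (n + 1)) ≤ cantorMixture.real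
      (Set.Icc (maskedReal (N + 1) b - (2 ^ (n + 1))⁻¹)
        (maskedReal (N + 1) b + (2 ^ (n + 1))⁻¹)) :=
    (ENNReal.ofReal_le_iff_le_toReal (measure_ne_top _ _)).1 (hμ (n + 1))
  rw [Complex.norm_exp, Real.log_exp, abs_of_neg hneg, le_div_iff₀ (neg_pos.2 hneg)]
  refine le_trans ?_ (le_re_herglotzIntegral hr.1.le h1 h2)
  calc c / 8 * -Real.log (1 - r) ≤ c / 8 * (n + 1) := by gcongr
    _ = 2 ^ n / 4 * (c * ((n + 1 : ℕ) / 2 ^ (n + 1))) := by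
        push_cast
        rw [pow_succ]
        field_simp
        norm_num
    _ ≤ _ := by gcongr

/-- There is `f ∈ A^{-∞}` with `|f|` bounded below by a positive constant and
`H_λ(D_+(f)) = ∞` for `λ(t) = t |log t|`. -/
theorem stmt7 :
    ∃ f : ℂ → ℂ, Korenblum f ∧ (∃ m : ℝ, 0 < m ∧ ∀ z ∈ Metric.ball (0:ℂ) 1, m ≤ ‖f z‖) ∧
      hausdorffGauge (fun t => t * |Real.log t|) (Dplus f) = ⊤ := by
  refine ⟨fun z => Complex.exp (herglotzIntegral cantorMixture z),
    korenblum_exp_herglotzIntegral_cantorMixture, ⟨1, one_pos, fun z hz => ?_⟩, ?_⟩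
  · rw [Complex.norm_exp, Real.one_le_exp_iff]
    exact re_herglotzIntegral_nonneg (mem_ball_zero_iff.1 hz)
  · have h : ∀ N : ℕ, ENNReal.ofReal ((N + 1 : ℕ) / 24) ≤
        hausdorffGauge (fun t => t * |Real.log t|)
          (Dplus fun z => Complex.exp (herglotzIntegral cantorMixture z)) := fun N =>
      ofReal_le_hausdorffGauge N.succ_pos (Set.range_subset_iff.2 (maskedReal_mem_Dplus N))
    have hlim : Tendsto (fun N : ℕ => ENNReal.ofReal ((N + 1 : ℕ) / 24)) atTop (nhds ⊤) :=
      ENNReal.tendsto_ofReal_nhds_top.2 <| Tendsto.atTop_div_const (by norm_num)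
        (tendsto_natCast_atTop_atTop.comp (tendsto_add_atTop_nat 1))
    exact top_le_iff.1 (le_of_tendsto' hlim h)
end
end
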